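/- Every point (ω, η) of the boundary ∂Ω₂ = Ω̄₂ ∖ Ω₂ satisfies ω ∈ Σ₂ and η ∈ Σ₂; that is, each coordinate of a boundary point is a nonempty subset of W containing the empty word, closed under prefixes, and in which every word has at least one one-letter extension. -/

import Mathlib

open Set MeasureTheory Filter Topology

/-- The binary Cantor space. -/
abbrev CantorC : Type := ℕ → Bool

/-- Finite binary words. -/
abbrev BWord : Type := List Bool

/-- Prepend a finite word to an infinite binary sequence. -/
def wordApp (w : BWord) (x : CantorC) : CantorC := fun n =>
  if h : n < w.length then w.get ⟨n, h⟩ else x (n - w.length)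

/-- The cylinder of sequences beginning with the word `w`. -/
def cyl (w : BWord) : Set CantorC := Set.range (wordApp w)

/-- `J` is a code: both the α-cylinders and the β-cylinders form a partition of the
Cantor space (every point lies in the cylinder of exactly one pair). -/
def IsCode (J : Finset (BWord × BWord)) : Prop :=
  (∀ x : CantorC, ∃! p : BWord × BWord, p ∈ J ∧ x ∈ cyl p.1) ∧
  (∀ x : CantorC, ∃! p : BWord × BWord, p ∈ J ∧ x ∈ cyl p.2)

/-- `J` is order preserving: α ≺ α' lexicographically iff β ≺ β' lexicographically. -/
def OrdPres (J : Finset (BWord × BWord)) : Prop :=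
  ∀ p ∈ J, ∀ q ∈ J, (List.Lex (· < ·) p.1 q.1 ↔ List.Lex (· < ·) p.2 q.2)

/-- The bijection `g` is induced by the code `J` : it maps `β·x` to `α·x`. -/
def InducedBy (J : Finset (BWord × BWord)) (g : Equiv.Perm CantorC) : Prop :=
  ∀ p ∈ J, ∀ x : CantorC, g (wordApp p.2 x) = wordApp p.1 x

/-- `J` is an order-preserving code inducing the bijection `g`. -/
def IsCodeFor (J : Finset (BWord × BWord)) (g : Equiv.Perm CantorC) : Prop :=
  IsCode J ∧ OrdPres J ∧ InducedBy J g

/-- Membership in (the realization on the Cantor space of) Thompson's group `F`. -/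
def InF (g : Equiv.Perm CantorC) : Prop := ∃ J, IsCodeFor J g

/-- The pair `(α, β)` has `|α| ≡ |β| (mod 2)`. -/
def EvenPair (p : BWord × BWord) : Prop := p.1.length % 2 = p.2.length % 2

/-- Membership in the subgroup `H₂` : some order-preserving code for `g` has all
pairs of even length difference. -/
def InH2 (g : Equiv.Perm CantorC) : Prop :=
  ∃ J, IsCodeFor J g ∧ ∀ p ∈ J, EvenPair p

/-- The union of the α-cylinders over pairs of even length difference. -/
def pSet (J : Finset (BWord × BWord)) : Set CantorC :=
  {x | ∃ p ∈ J, EvenPair p ∧ x ∈ cyl p.1}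

/-- The union of the β-cylinders over pairs of even length difference. -/
def eSet (J : Finset (BWord × BWord)) : Set CantorC :=
  {x | ∃ p ∈ J, EvenPair p ∧ x ∈ cyl p.2}

/-- `p_f` : for `f ∈ F` this equals `pSet J` for any (equivalently, every)
order-preserving code `J` for `f`. -/
def pF (g : Equiv.Perm CantorC) : Set CantorC :=
  ⋃ J ∈ {J : Finset (BWord × BWord) | IsCodeFor J g}, pSet J

/-- `E_f` : for `f ∈ F` this equals `eSet J` for any (equivalently, every)
order-preserving code `J` for `f`. -/
def EF (g : Equiv.Perm CantorC) : Set CantorC :=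
  ⋃ J ∈ {J : Finset (BWord × BWord) | IsCodeFor J g}, eSet J

/-- `Ω₂ = {p_f : f ∈ F}`. -/
def Omega2 : Set (Set CantorC) := {p | ∃ g, InF g ∧ pF g = p}

/-- The action `f · p = f(p ∩ E_f) ∪ f((C ∖ p) ∩ (C ∖ E_f))`. -/
def actF (g : Equiv.Perm CantorC) (p : Set CantorC) : Set CantorC :=
  g '' (p ∩ EF g) ∪ g '' (pᶜ ∩ (EF g)ᶜ)

open Classical in
/-- `T(p)` as a Boolean-valued characteristic function: `T(p) w = true` iff the
cylinder of `w` meets `p`. -/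
noncomputable def Tb (p : Set CantorC) : BWord → Bool :=
  fun w => if (cyl w ∩ p).Nonempty then true else false

/-- The embedding `p ↦ (T(p), T(C ∖ p))`. -/
noncomputable def embedT (p : Set CantorC) : (BWord → Bool) × (BWord → Bool) :=
  (Tb p, Tb pᶜ)

/-- `Ω̄₂` : the closure of the image of `Ω₂` under the embedding. -/
noncomputable def OmegaBar : Set ((BWord → Bool) × (BWord → Bool)) :=
  closure (embedT '' Omega2)

/-- `ω` belongs to `Σ₂`: it contains the empty word, is closed under prefixes, and
every word in it has a one-letter extension in it. -/
def InSigma2 (ω : BWord → Bool) : Prop :=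
  ω [] = true ∧
  (∀ v w : BWord, v <+: w → ω w = true → ω v = true) ∧
  (∀ w : BWord, ω w = true → ∃ b : Bool, ω (w ++ [b]) = true)

theorem Tb_eq_true_iff {p : Set CantorC} {w : BWord} :
    Tb p w = true ↔ (cyl w ∩ p).Nonempty := by
  simp [Tb]

theorem wordApp_append (v u : BWord) (x : CantorC) :
    wordApp (v ++ u) x = wordApp v (wordApp u x) := by
  funext n
  simp only [wordApp, List.length_append, List.get_eq_getElem, List.getElem_append]
  split_ifs <;> first | rfl | omega | (congr 1; omega)

theorem cyl_append_subset (v u : BWord) : cyl (v ++ u) ⊆ cyl v := by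
  rintro _ ⟨x, rfl⟩
  exact ⟨wordApp u x, (wordApp_append v u x).symm⟩

theorem wordApp_nil (x : CantorC) : wordApp [] x = x := by
  funext n
  simp [wordApp]

theorem cyl_nil : cyl [] = Set.univ :=
  Set.eq_univ_of_forall fun x => ⟨x, wordApp_nil x⟩

theorem wordApp_head_tail (x : CantorC) : wordApp [x 0] (fun n => x (n + 1)) = x := by
  funext n
  cases n <;> simp [wordApp]

theorem Tb_nil_eq_false_iff {p : Set CantorC} : Tb p [] = false ↔ p = ∅ := by
  rw [← Bool.not_eq_true, Tb_eq_true_iff, cyl_nil, Set.univ_inter,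
    Set.not_nonempty_iff_eq_empty]

theorem Tb_of_prefix {p : Set CantorC} {v w : BWord} (h : v <+: w) (hw : Tb p w = true) :
    Tb p v = true := by
  obtain ⟨u, rfl⟩ := h
  rw [Tb_eq_true_iff] at hw ⊢
  exact hw.mono (Set.inter_subset_inter_left _ (cyl_append_subset v u))

theorem exists_Tb_append {p : Set CantorC} {w : BWord} (hw : Tb p w = true) :
    ∃ b : Bool, Tb p (w ++ [b]) = true := by
  obtain ⟨_, ⟨x, rfl⟩, hx⟩ := Tb_eq_true_iff.1 hw
  refine ⟨x 0, Tb_eq_true_iff.2 ⟨wordApp w x, ⟨fun n => x (n + 1), ?_⟩, hx⟩⟩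
  rw [wordApp_append, wordApp_head_tail]

theorem Tb_or_Tb_compl (p : Set CantorC) (w : BWord) : Tb p w = true ∨ Tb pᶜ w = true := by
  simp only [Tb_eq_true_iff]
  by_cases h : wordApp w (fun _ => false) ∈ p
  · exact Or.inl ⟨_, ⟨_, rfl⟩, h⟩
  · exact Or.inr ⟨_, ⟨_, rfl⟩, h⟩

/-- A point of the closure agrees with some point of `Ω₂` on any finite set of words. -/
theorem exists_mem_Omega2_agree {x : (BWord → Bool) × (BWord → Bool)} (hx : x ∈ OmegaBar)
    (s : Finset BWord) :
    ∃ p ∈ Omega2, ∀ w ∈ s, Tb p w = x.1 w ∧ Tb pᶜ w = x.2 w := by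
  have hopen : IsOpen {y : (BWord → Bool) × (BWord → Bool) |
      ∀ w ∈ s, y.1 w = x.1 w ∧ y.2 w = x.2 w} := by
    simp only [Set.ofPred_forall, Set.ofPred_and]
    refine isOpen_biInter_finset fun w _ => IsOpen.inter ?_ ?_
    · exact (isOpen_discrete {x.1 w}).preimage
        (f := fun y : (BWord → Bool) × (BWord → Bool) => y.1 w) (by fun_prop)
    · exact (isOpen_discrete {x.2 w}).preimage
        (f := fun y : (BWord → Bool) × (BWord → Bool) => y.2 w) (by fun_prop)
  obtain ⟨_, hy, p, hp, rfl⟩ := mem_closure_iff.1 hx _ hopen fun _ _ => ⟨rfl, rfl⟩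
  exact ⟨p, hp, hy⟩

/-- each coordinate of any boundary point `(ω, η) ∈ ∂Ω₂ = Ω̄₂ ∖ Ω₂`
belongs to `Σ₂`. -/
theorem stmt16 (x : (BWord → Bool) × (BWord → Bool))
    (hx : x ∈ OmegaBar) (hx' : x ∉ embedT '' Omega2) :
    InSigma2 x.1 ∧ InSigma2 x.2 := by
  have prefix_closed : ∀ v w : BWord, v <+: w →
      (x.1 w = true → x.1 v = true) ∧ (x.2 w = true → x.2 v = true) := by
    intro v w hvw
    obtain ⟨p, -, hp⟩ := exists_mem_Omega2_agree hx {v, w}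
    have hv := hp v (by simp)
    have hw := hp w (by simp)
    rw [← hv.1, ← hv.2, ← hw.1, ← hw.2]
    exact ⟨Tb_of_prefix hvw, Tb_of_prefix hvw⟩
  have extendable : ∀ w : BWord, (x.1 w = true → ∃ b, x.1 (w ++ [b]) = true) ∧
      (x.2 w = true → ∃ b, x.2 (w ++ [b]) = true) := by
    intro w
    obtain ⟨p, -, hp⟩ :=
      exists_mem_Omega2_agree hx {w, w ++ [false], w ++ [true]}
    have hb : ∀ b, Tb p (w ++ [b]) = x.1 (w ++ [b]) ∧ Tb pᶜ (w ++ [b]) = x.2 (w ++ [b]) :=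
      fun b => hp _ (by cases b <;> simp)
    have hw := hp w (by simp)
    simp only [← (hb _).1, ← (hb _).2, ← hw.1, ← hw.2]
    exact ⟨exists_Tb_append, exists_Tb_append⟩
  have cover : ∀ w, x.1 w = true ∨ x.2 w = true := by
    intro w
    obtain ⟨p, -, hp⟩ := exists_mem_Omega2_agree hx {w}
    have hw := hp w (by simp)
    rw [← hw.1, ← hw.2]
    exact Tb_or_Tb_compl p w
  obtain ⟨p, hpΩ, hp⟩ := exists_mem_Omega2_agree hx {[]}
  have hnil := hp [] (by simp)
  have Tb_empty : ∀ w, Tb ∅ w = false := fun w => by simp [Tb]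
  have Tb_univ : ∀ w, Tb Set.univ w = true := fun w => by
    simpa [Tb_empty] using Tb_or_Tb_compl ∅ w
  have fst_nil : x.1 [] = true := by
    by_contra h
    obtain rfl : p = ∅ := Tb_nil_eq_false_iff.1 (hnil.1.trans (by simpa using h))
    have h1 : ∀ w, x.1 w ≠ true := fun w hw => h ((prefix_closed [] w w.nil_prefix).1 hw)
    refine hx' ⟨∅, hpΩ, Prod.ext (funext fun w => ?_) (funext fun w => ?_)⟩
    · simpa [embedT, Tb_empty] using h1 w
    · simpa [embedT, Tb_univ] using (cover w).resolve_left (h1 w)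
  have snd_nil : x.2 [] = true := by
    by_contra h
    obtain rfl : p = Set.univ := Set.compl_empty_iff.1
      (Tb_nil_eq_false_iff.1 (hnil.2.trans (by simpa using h)))
    have h2 : ∀ w, x.2 w ≠ true := fun w hw => h ((prefix_closed [] w w.nil_prefix).2 hw)
    refine hx' ⟨Set.univ, hpΩ, Prod.ext (funext fun w => ?_) (funext fun w => ?_)⟩
    · simpa [embedT, Tb_univ] using (cover w).resolve_right (h2 w)
    · simpa [embedT, Tb_empty] using h2 w
  exact ⟨⟨fst_nil, fun v w h => (prefix_closed v w h).1, fun w => (extendable w).1⟩,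
    ⟨snd_nil, fun v w h => (prefix_closed v w h).2, fun w => (extendable w).2⟩⟩
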